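/- Let H be a separable real Hilbert space, X a measurable space, ψ : X → H a measurable feature map with ‖ψ(x)‖ ≤ R for all x ∈ X, and μ a probability measure on X. Fix m ≥ 1 and let Π⊥ : X^m → B(H) be a measurable map such that Π⊥(s) is an orthogonal projection operator for every s ∈ X^m (in particular, the orthogonal projection onto the orthogonal complement V̂_k^⊥(s) of the subspace spanned by k eigenvectors of the sample covariance C(s) corresponding to its k largest eigenvalues). Then for every δ ∈ (0,1], with probability at least 1 − δ over an iid 2m-sample S = S₁ ∪ S₂ with S₁ = (x₁,…,x_m), S₂ = (x_{m+1},…,x_{2m}) drawn from μ^{2m}: E_{x∼μ}[‖Π⊥(S₁)ψ(x)‖²] ≤ (1/m) Σ_{i=1}^m ‖Π⊥(S₁)ψ(x_{m+i})‖² + R²·√((2/m)·log(1/δ)). -/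

import Mathlib

open MeasureTheory ProbabilityTheory

/-- A self-adjoint idempotent operator does not increase the norm. -/
lemma norm_apply_le_of_isSelfAdjoint_of_comp_self {H : Type*} [NormedAddCommGroup H]
    [InnerProductSpace ℝ H] [CompleteSpace H] {P : H →L[ℝ] H}
    (hsa : IsSelfAdjoint P) (hid : P.comp P = P) (v : H) : ‖P v‖ ≤ ‖v‖ := by
  have hinner : ‖P v‖ * ‖P v‖ = inner ℝ v (P v) := by
    rw [← real_inner_self_eq_norm_mul_norm, ← ContinuousLinearMap.adjoint_inner_right,
      hsa.adjoint_eq, ← ContinuousLinearMap.comp_apply, hid]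
  have hle : ‖P v‖ * ‖P v‖ ≤ ‖v‖ * ‖P v‖ := hinner ▸ real_inner_le_norm _ _
  by_contra! hlt
  nlinarith [norm_nonneg v]

section Hoeffding

variable {X ι : Type*} [MeasurableSpace X] [Fintype ι] {μ : Measure X} [IsProbabilityMeasure μ]
  {f : X → ℝ} {B : ℝ}

/-- One-sided Hoeffding inequality for an iid sample of a function with values in `[0, B]`. -/
lemma measureReal_pi_sum_integral_sub_ge_le (hf : Measurable f)
    (hfB : ∀ x, f x ∈ Set.Icc 0 B) {ε : ℝ} (hε : 0 ≤ ε) :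
    (Measure.pi fun _ : ι => μ).real {y | ε ≤ ∑ i, (∫ x, f x ∂μ - f (y i))} ≤
      Real.exp (-ε ^ 2 / (2 * (Fintype.card ι * (B / 2) ^ 2))) := by
  have hindep : iIndepFun (fun (i : ι) (y : ι → X) => ∫ x, f x ∂μ - f (y i))
      (Measure.pi fun _ => μ) :=
    iIndepFun_pi (X := fun _ x => ∫ x, f x ∂μ - f x) fun _ => by fun_prop
  have hsub (i : ι) : HasSubgaussianMGF (fun y : ι → X => ∫ x, f x ∂μ - f (y i))
      ((‖(0 : ℝ) - -B‖₊ / 2) ^ 2) (Measure.pi fun _ => μ) := by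
    have hmean : ∫ y : ι → X, f (y i) ∂(Measure.pi fun _ => μ) = ∫ x, f x ∂μ :=
      integral_comp_eval hf.aestronglyMeasurable
    have := hasSubgaussianMGF_of_mem_Icc (X := fun y : ι → X => -f (y i)) (a := -B) (b := 0)
      (μ := Measure.pi fun _ => μ)
      (hf.comp (measurable_pi_apply i)).neg.aemeasurable
      (.of_forall fun y => ⟨neg_le_neg (hfB _).2, neg_nonpos.2 (hfB _).1⟩)
    simpa only [integral_neg, hmean, sub_neg_eq_add, neg_add_eq_sub] using this
  refine (HasSubgaussianMGF.measure_sum_ge_le_of_iIndepFun hindep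
    (s := Finset.univ) (fun i _ => hsub i) hε).trans_eq ?_
  simp [div_pow]

/-- The mean of a function with values in `[0, B]` exceeds its empirical mean over an iid sample
by at most `B √((2/m) log (1/δ))` with probability at least `1 - δ`. -/
lemma ofReal_one_sub_le_measure_pi_integral_le [Nonempty ι] (hf : Measurable f)
    (hfB : ∀ x, f x ∈ Set.Icc 0 B) {δ : ℝ} (hδ : δ ∈ Set.Ioc (0 : ℝ) 1) :
    ENNReal.ofReal (1 - δ) ≤ (Measure.pi fun _ : ι => μ)
      {y | ∫ x, f x ∂μ ≤ (1 / (Fintype.card ι : ℝ)) * ∑ i, f (y i) +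
        B * √((2 / (Fintype.card ι : ℝ)) * Real.log (1 / δ))} := by
  obtain ⟨x₀⟩ : Nonempty X := nonempty_of_isProbabilityMeasure μ
  have hB : 0 ≤ B := (hfB x₀).1.trans (hfB x₀).2
  have hm : (0 : ℝ) < Fintype.card ι := by exact_mod_cast Fintype.card_pos
  set m := (Fintype.card ι : ℝ)
  set L := Real.log (1 / δ) with hL
  have hL0 : 0 ≤ L := Real.log_nonneg (by rw [le_div_iff₀ hδ.1]; linarith [hδ.2])
  obtain rfl | hBpos := hB.eq_or_lt
  · have hf0 (x : X) : f x = 0 := le_antisymm (hfB x).2 (hfB x).1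
    simpa [hf0] using hδ.1.le
  set s := {y : ι → X | ∫ x, f x ∂μ ≤ (1 / m) * ∑ i, f (y i) + B * √((2 / m) * L)}
  have hs : MeasurableSet s := measurableSet_le measurable_const (by fun_prop)
  have hcompl : (Measure.pi fun _ : ι => μ).real sᶜ ≤ δ := by
    calc (Measure.pi fun _ : ι => μ).real sᶜ
      _ ≤ (Measure.pi fun _ : ι => μ).real
          {y | m * (B * √((2 / m) * L)) ≤ ∑ i, (∫ x, f x ∂μ - f (y i))} := by
        refine measureReal_mono fun y hy => ?_
        have hy : (1 / m) * ∑ i, f (y i) + B * √((2 / m) * L) < ∫ x, f x ∂μ := not_le.1 hy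
        have hmul := mul_lt_mul_of_pos_left hy hm
        rw [mul_add, ← mul_assoc, mul_one_div_cancel hm.ne', one_mul] at hmul
        simp only [Set.mem_ofPred_eq, Finset.sum_sub_distrib, Finset.sum_const, Finset.card_univ,
          nsmul_eq_mul]
        linarith
      _ ≤ Real.exp (-(m * (B * √((2 / m) * L))) ^ 2 / (2 * (m * (B / 2) ^ 2))) :=
        measureReal_pi_sum_integral_sub_ge_le hf hfB (by positivity)
      _ = Real.exp (-(4 * L)) := by
        rw [mul_pow, mul_pow, Real.sq_sqrt (by positivity)]
        congr 1
        field_simp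
        ring
      _ ≤ Real.exp (-L) := by gcongr; linarith
      _ = δ := by rw [hL, one_div, Real.log_inv, neg_neg, Real.exp_log hδ.1]
  rw [probReal_compl_eq_one_sub hs] at hcompl
  exact ENNReal.ofReal_le_of_le_toReal (by change _ ≤ Measure.real _ _; linarith)

end Hoeffding

/-- A uniform lower bound on the measures of the sections of a measurable set is a lower bound on
its measure for a product of probability measures. -/
lemma le_measure_prod_of_forall_le {α β : Type*} [MeasurableSpace α] [MeasurableSpace β]
    {μ : Measure α} {ν : Measure β} [IsProbabilityMeasure μ] [SFinite ν]
    {s : Set (α × β)} (hs : MeasurableSet s) {c : ENNReal}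
    (h : ∀ x, c ≤ ν (Prod.mk x ⁻¹' s)) : c ≤ μ.prod ν s := by
  rw [Measure.prod_apply hs]
  simpa using lintegral_mono (μ := μ) h

/-- **PAC upper bound on the expected squared residual (Theorem 4 of the paper).**
If `ψ : X → H` is a bounded measurable feature map into a separable real Hilbert space,
`P` assigns to each `m`-sample `s` an orthogonal projection operator `P s` on `H`
(e.g. the projection onto the orthogonal complement of the span of the top `k` eigenvectors
of the sample covariance), then with probability at least `1 - δ` over an iid `2m`-sample
`S = (S₁, S₂)` from `μ`, the expected squared residual of a fresh point is upper bounded by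
the empirical average over the second half of the sample plus `R² √((2/m) log(1/δ))`. -/
theorem stmt_1
    {H : Type*} [NormedAddCommGroup H] [InnerProductSpace ℝ H] [CompleteSpace H]
    [SecondCountableTopology H] [MeasurableSpace H] [BorelSpace H]
    {X : Type*} [MeasurableSpace X]
    [MeasurableSpace (H →L[ℝ] H)] [BorelSpace (H →L[ℝ] H)]
    (ψ : X → H) (hψ : Measurable ψ)
    (R : ℝ) (hR : ∀ x, ‖ψ x‖ ≤ R)
    (μ : Measure X) [IsProbabilityMeasure μ]
    (m : ℕ) (hm : 1 ≤ m)
    (Pperp : (Fin m → X) → (H →L[ℝ] H))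
    (hPmeas : Measurable Pperp)
    (hPproj : ∀ s, IsSelfAdjoint (Pperp s) ∧ (Pperp s).comp (Pperp s) = Pperp s)
    (δ : ℝ) (hδ : δ ∈ Set.Ioc (0:ℝ) 1) :
    ENNReal.ofReal (1 - δ) ≤
      ((Measure.pi fun _ : Fin m => μ).prod (Measure.pi fun _ : Fin m => μ))
        {S : (Fin m → X) × (Fin m → X) |
          ∫ x, ‖Pperp S.1 (ψ x)‖ ^ 2 ∂μ
          ≤ (1 / (m:ℝ)) * ∑ i : Fin m, ‖Pperp S.1 (ψ (S.2 i))‖ ^ 2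
            + R ^ 2 * Real.sqrt ((2 / (m:ℝ)) * Real.log (1 / δ))} := by
  have hjoint : Measurable fun p : (Fin m → X) × X => ‖Pperp p.1 (ψ p.2)‖ ^ 2 := by
    have happly : Measurable (Function.uncurry fun (h : H) (s : Fin m → X) => Pperp s h) :=
      measurable_uncurry_of_continuous_of_measurable (fun s => (Pperp s).continuous) fun h =>
        (ContinuousLinearMap.apply ℝ H h).continuous.measurable.comp hPmeas
    exact (happly.comp ((hψ.comp measurable_snd).prodMk measurable_fst)).norm.pow_const 2
  have hsec (s : Fin m → X) : Measurable fun x => ‖Pperp s (ψ x)‖ ^ 2 :=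
    hjoint.comp measurable_prodMk_left
  have hbound (s : Fin m → X) (x : X) : ‖Pperp s (ψ x)‖ ^ 2 ∈ Set.Icc 0 (R ^ 2) :=
    ⟨by positivity, pow_le_pow_left₀ (norm_nonneg _)
      ((norm_apply_le_of_isSelfAdjoint_of_comp_self (hPproj s).1 (hPproj s).2 _).trans (hR x)) 2⟩
  have hmean : Measurable fun s : Fin m → X => ∫ x, ‖Pperp s (ψ x)‖ ^ 2 ∂μ :=
    hjoint.stronglyMeasurable.integral_prod_right.measurable
  have hemp (i : Fin m) : Measurable fun S : (Fin m → X) × (Fin m → X) =>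
      ‖Pperp S.1 (ψ (S.2 i))‖ ^ 2 :=
    hjoint.comp (measurable_fst.prodMk ((measurable_pi_apply i).comp measurable_snd))
  refine le_measure_prod_of_forall_le (measurableSet_le (hmean.comp measurable_fst)
    (((Finset.measurable_fun_sum _ fun i _ => hemp i).const_mul _).add_const _)) fun s => ?_
  have : Nonempty (Fin m) := ⟨⟨0, hm⟩⟩
  simpa only [Fintype.card_fin, Set.preimage_ofPred_eq, Function.comp_apply] using
    ofReal_one_sub_le_measure_pi_integral_le (ι := Fin m) (μ := μ) (hsec s) (hbound s) hδ
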